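/- arXiv:2602.06102 — 2 statements merged into one kernel-verified Lean document; each statement's English description precedes it below -/
import Mathlib

section
/- Complex Kharitonov theorem (K8PT): Let N ≥ 1 and let la, ua, lb, ub : {0,…,N} → ℝ satisfy la n ≤ ua n and lb n ≤ ub n for all n, and assume the leading coefficient box excludes zero, i.e. it is not the case that both la N ≤ 0 ≤ ua N and lb N ≤ 0 ≤ ub N. If the eight Kharitonov polynomials K₁,…,K₈ of the family are all Hurwitz, then every member polynomial P_{a,b}(s) = Σ_{n=0}^N (a_n + i b_n) s^n with la n ≤ a_n ≤ ua n and lb n ≤ b_n ≤ ub n is Hurwitz. -/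
open Polynomial

/-- The member polynomial `∑ (a n + i b n) s^n` of an interval family. -/
noncomputable def member (N : ℕ) (a b : ℕ → ℝ) : Polynomial ℂ :=
  ∑ n ∈ Finset.range (N + 1), C ((a n : ℂ) + (b n : ℂ) * Complex.I) * X ^ n

/-- Pattern selection according to `n % 4`: `true` means take the upper endpoint. -/
def pat (w x y z : Bool) (n : ℕ) : Bool :=
  match n % 4 with
  | 0 => w
  | 1 => x
  | 2 => y
  | _ => z

/-- Pick the lower or upper endpoint according to the pattern. -/
def pick (l u : ℕ → ℝ) (p : ℕ → Bool) (n : ℕ) : ℝ := if p n then u n else l n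

/-- A polynomial is Hurwitz if it is nonzero and has no roots with nonnegative real part. -/
def Hurwitz (P : Polynomial ℂ) : Prop :=
  P ≠ 0 ∧ ∀ z : ℂ, 0 ≤ z.re → P.eval z ≠ 0

/-- The members of the interval family with the given coefficient bounds. -/
def intervalFamily (N : ℕ) (la ua lb ub : ℕ → ℝ) : Set ℂ[X] :=
  {P | ∃ a b : ℕ → ℝ, (∀ n ≤ N, la n ≤ a n ∧ a n ≤ ua n) ∧
    (∀ n ≤ N, lb n ≤ b n ∧ b n ≤ ub n) ∧ P = member N a b}

lemma coeff_member (N : ℕ) (a b : ℕ → ℝ) (n : ℕ) :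
    (member N a b).coeff n = if n ≤ N then (a n : ℂ) + (b n : ℂ) * Complex.I else 0 := by
  simp only [member, finsetSum_coeff, coeff_C_mul_X_pow]
  simp

lemma eval_member (N : ℕ) (a b : ℕ → ℝ) (z : ℂ) :
    (member N a b).eval z =
      ∑ n ∈ Finset.range (N + 1), ((a n : ℂ) + (b n : ℂ) * Complex.I) * z ^ n := by
  simp [member, eval_finsetSum]

lemma natDegree_member {N : ℕ} {a b : ℕ → ℝ} (h : (a N : ℂ) + (b N : ℂ) * Complex.I ≠ 0) :
    (member N a b).natDegree = N := by
  apply le_antisymm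
  · rw [natDegree_le_iff_coeff_eq_zero]
    intro n hn
    rw [coeff_member, if_neg (by omega)]
  · apply le_natDegree_of_ne_zero
    simpa [coeff_member] using h

lemma convex_intervalFamily (N : ℕ) (la ua lb ub : ℕ → ℝ) :
    Convex ℝ (intervalFamily N la ua lb ub) := by
  rintro _ ⟨a, b, ha, hb, rfl⟩ _ ⟨a', b', ha', hb', rfl⟩ s t hs ht hst
  refine ⟨fun n => s * a n + t * a' n, fun n => s * b n + t * b' n, ?_, ?_, ?_⟩
  · intro n hn
    exact convex_Icc (la n) (ua n) (ha n hn) (ha' n hn) hs ht hst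
  · intro n hn
    exact convex_Icc (lb n) (ub n) (hb n hn) (hb' n hn) hs ht hst
  · ext n
    simp only [coeff_add, coeff_smul, coeff_member, Complex.real_smul]
    split_ifs
    · push_cast
      ring
    · simp

/-- A coefficient box that excludes zero is bounded away from zero. -/
lemma exists_pos_le_norm_of_box {l u l' u' : ℝ} (h : ¬ (l ≤ 0 ∧ 0 ≤ u ∧ l' ≤ 0 ∧ 0 ≤ u')) :
    ∃ c : ℝ, 0 < c ∧ ∀ x y : ℝ, l ≤ x ∧ x ≤ u → l' ≤ y ∧ y ≤ u' →
      c ≤ ‖(x : ℂ) + (y : ℂ) * Complex.I‖ := by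
  have hre : ∀ x y : ℝ, |x| ≤ ‖(x : ℂ) + (y : ℂ) * Complex.I‖ := fun x y => by
    simpa using Complex.abs_re_le_norm ((x : ℂ) + (y : ℂ) * Complex.I)
  have him : ∀ x y : ℝ, |y| ≤ ‖(x : ℂ) + (y : ℂ) * Complex.I‖ := fun x y => by
    simpa using Complex.abs_im_le_norm ((x : ℂ) + (y : ℂ) * Complex.I)
  by_cases h1 : l ≤ 0
  · by_cases h2 : 0 ≤ u
    · by_cases h3 : l' ≤ 0
      · have h4 : u' < 0 := by
          by_contra h4
          exact h ⟨h1, h2, h3, not_lt.mp h4⟩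
        exact ⟨-u', by linarith, fun x y _ hy =>
          le_trans (by linarith [neg_abs_le y, hy.2]) (him x y)⟩
      · exact ⟨l', by linarith, fun x y _ hy =>
          le_trans (by linarith [le_abs_self y, hy.1]) (him x y)⟩
    · exact ⟨-u, by linarith, fun x y hx _ =>
        le_trans (by linarith [neg_abs_le x, hx.2]) (hre x y)⟩
  · exact ⟨l, by linarith, fun x y hx _ =>
      le_trans (by linarith [le_abs_self x, hx.1]) (hre x y)⟩

/-- Uniform bound for the roots of polynomials with bounded coefficients and leading coefficient
bounded away from zero. -/
lemma norm_root_le {P : ℂ[X]} {c M : ℝ} (hc : 0 < c) (hlc : c ≤ ‖P.leadingCoeff‖)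
    (hM : ∀ n, ‖P.coeff n‖ ≤ M) {z : ℂ} (hz : P.eval z = 0) : ‖z‖ ≤ M / c + 1 := by
  have hP : P ≠ 0 := by
    rintro rfl
    simp at hlc
    linarith
  have hM0 : 0 ≤ M := (norm_nonneg _).trans (hM 0)
  have h := (IsRoot.norm_lt_cauchyBound hP (a := z) hz).le
  rw [cauchyBound, ← NNReal.coe_le_coe] at h
  push_cast at h
  refine h.trans ?_
  have hsup : (((Finset.range P.natDegree).sup (‖P.coeff ·‖₊) : NNReal) : ℝ) ≤ M := by
    have : (Finset.range P.natDegree).sup (‖P.coeff ·‖₊) ≤ (⟨M, hM0⟩ : NNReal) :=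
      Finset.sup_le fun n _ => hM n
    exact this
  gcongr

lemma exists_bounds_intervalFamily {N : ℕ} {la ua lb ub : ℕ → ℝ}
    (hlead : ¬ (la N ≤ 0 ∧ 0 ≤ ua N ∧ lb N ≤ 0 ∧ 0 ≤ ub N)) :
    ∃ c ρ : ℝ, 0 < c ∧ ∀ P ∈ intervalFamily N la ua lb ub, P.natDegree = N ∧
      c ≤ ‖P.leadingCoeff‖ ∧ ∀ z : ℂ, P.eval z = 0 → ‖z‖ ≤ ρ := by
  obtain ⟨c, hc, hbox⟩ := exists_pos_le_norm_of_box hlead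
  refine ⟨c, (∑ n ∈ Finset.range (N + 1), (|la n| + |ua n| + |lb n| + |ub n|)) / c + 1, hc, ?_⟩
  rintro _ ⟨a, b, ha, hb, rfl⟩
  have hN := hbox _ _ (ha N le_rfl) (hb N le_rfl)
  have hdeg : (member N a b).natDegree = N :=
    natDegree_member (norm_pos_iff.mp (hc.trans_le hN))
  have hlc : c ≤ ‖(member N a b).leadingCoeff‖ := by
    simpa [leadingCoeff, hdeg, coeff_member] using hN
  refine ⟨hdeg, hlc, fun z hz => norm_root_le hc hlc (fun n => ?_) hz⟩
  have hnn : ∀ n ∈ Finset.range (N + 1), 0 ≤ |la n| + |ua n| + |lb n| + |ub n| :=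
    fun n _ => by positivity
  rw [coeff_member]
  split_ifs with hn
  · refine le_trans ?_ (Finset.single_le_sum hnn (Finset.mem_range.mpr (Nat.lt_succ_of_le hn)))
    have h1 : ‖(a n : ℂ) + (b n : ℂ) * Complex.I‖ ≤ |a n| + |b n| :=
      (norm_add_le _ _).trans (by simp)
    have h2 : |a n| ≤ |la n| + |ua n| := by
      obtain ⟨h, h'⟩ := ha n hn
      rw [abs_le]
      constructor <;> linarith [neg_abs_le (la n), le_abs_self (ua n), abs_nonneg (la n),
        abs_nonneg (ua n)]
    have h3 : |b n| ≤ |lb n| + |ub n| := by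
      obtain ⟨h, h'⟩ := hb n hn
      rw [abs_le]
      constructor <;> linarith [neg_abs_le (lb n), le_abs_self (ub n), abs_nonneg (lb n),
        abs_nonneg (ub n)]
    linarith
  · simpa using Finset.sum_nonneg hnn

lemma Hurwitz.re_lt_zero_of_mem_roots {P : ℂ[X]} (hP : Hurwitz P) {r : ℂ} (hr : r ∈ P.roots) :
    r.re < 0 := by
  by_contra h
  exact hP.2 r (not_lt.mp h) (isRoot_of_mem_roots hr)

/-- In the closed right half-plane a Hurwitz polynomial is bounded below in terms of its
leading coefficient and degree. -/
lemma Hurwitz.le_norm_eval {P : ℂ[X]} (hP : Hurwitz P) {z : ℂ} (hz : 0 ≤ z.re) :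
    ‖P.leadingCoeff‖ * z.re ^ P.natDegree ≤ ‖P.eval z‖ := by
  have hs : P.Splits := IsAlgClosed.splits P
  rw [hs.eval_eq_prod_roots, norm_mul, hs.natDegree_eq_card_roots]
  gcongr
  have key : ∀ s : Multiset ℂ, (∀ r ∈ s, r.re < 0) →
      z.re ^ s.card ≤ ‖(s.map fun r => z - r).prod‖ := by
    intro s
    induction s using Multiset.induction_on with
    | empty => simp
    | cons r s ih =>
      intro h
      have h1 := ih fun x hx => h x (Multiset.mem_cons_of_mem hx)
      have h2 : z.re ≤ ‖z - r‖ := by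
        have := Complex.re_le_norm (z - r)
        have := h r (Multiset.mem_cons_self r s)
        simp only [Complex.sub_re] at *
        linarith
      rw [Multiset.card_cons, Multiset.map_cons, Multiset.prod_cons, norm_mul, pow_succ']
      gcongr
  exact key _ fun r hr => hP.re_lt_zero_of_mem_roots hr

/-- The logarithmic derivative of a nonconstant Hurwitz polynomial has positive real part on the
closed right half-plane. -/
lemma Hurwitz.re_logDeriv_pos {P : ℂ[X]} (hP : Hurwitz P) (hdeg : P.natDegree ≠ 0) {z : ℂ}
    (hz : 0 ≤ z.re) : 0 < (P.derivative.eval z / P.eval z).re := by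
  have hs : P.Splits := IsAlgClosed.splits P
  rw [hs.eval_derivative_div_eval_of_ne_zero (hP.2 z hz)]
  have key : ∀ s : Multiset ℂ, (∀ r ∈ s, r.re < 0) →
      0 ≤ (s.map fun r => 1 / (z - r)).sum.re ∧
        (s ≠ 0 → 0 < (s.map fun r => 1 / (z - r)).sum.re) := by
    intro s
    induction s using Multiset.induction_on with
    | empty => simp
    | cons r s ih =>
      intro h
      have h1 := (ih fun x hx => h x (Multiset.mem_cons_of_mem hx)).1
      have h2 : 0 < (z - r).re := by
        have := h r (Multiset.mem_cons_self r s)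
        simp only [Complex.sub_re]
        linarith
      have h3 : 0 < (1 / (z - r)).re := by
        rw [one_div, Complex.inv_re]
        refine div_pos h2 (Complex.normSq_pos.mpr fun h0 => ?_)
        simp [h0] at h2
      rw [Multiset.map_cons, Multiset.sum_cons, Complex.add_re]
      exact ⟨by linarith, fun _ => by linarith⟩
  refine (key _ fun r hr => hP.re_lt_zero_of_mem_roots hr).2 fun h0 => hdeg ?_
  rw [hs.natDegree_eq_card_roots, h0, Multiset.card_zero]

lemma hasDerivAt_eval_ray (P : ℂ[X]) (u : ℂ) (τ : ℝ) :
    HasDerivAt (fun t : ℝ => P.eval (u * t)) (u * P.derivative.eval (u * τ)) τ := by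
  have h1 : HasDerivAt (fun t : ℝ => u * (t : ℂ)) u τ := by
    simpa using (Complex.ofRealCLM.hasDerivAt (x := τ)).const_mul u
  have h2 := (P.hasDerivAt (u * (τ : ℂ))).comp τ h1
  rw [mul_comm] at h2
  exact h2

/-- A Hurwitz polynomial has monotone phase along the imaginary axis. -/
lemma Hurwitz.phase_pos {P : ℂ[X]} (hP : Hurwitz P) (hdeg : P.natDegree ≠ 0) {σ : ℝ}
    (hσ : σ ≠ 0) (τ : ℝ) :
    0 < σ * ((P.eval (σ * Complex.I * τ)).re *
        ((σ * Complex.I) * P.derivative.eval (σ * Complex.I * τ)).im -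
      (P.eval (σ * Complex.I * τ)).im *
        ((σ * Complex.I) * P.derivative.eval (σ * Complex.I * τ)).re) := by
  have hz : 0 ≤ (σ * Complex.I * τ : ℂ).re := by simp
  have h := hP.re_logDeriv_pos hdeg hz
  have h0 := Complex.normSq_pos.mpr (hP.2 _ hz)
  set p := P.eval (σ * Complex.I * τ)
  set q := P.derivative.eval (σ * Complex.I * τ)
  have h1 : 0 < q.re * p.re + q.im * p.im := by
    rw [Complex.div_re, ← add_div] at h
    exact (div_pos_iff_of_pos_right h0).mp h
  have h2 : 0 < σ ^ 2 * (q.re * p.re + q.im * p.im) := by positivity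
  simp
  linarith

lemma exists_convex_combination_eq_zero {x y : ℝ} (hx : x ≤ 0) (hy : 0 ≤ y) :
    ∃ s t : ℝ, 0 ≤ s ∧ 0 ≤ t ∧ s + t = 1 ∧ s * x + t * y = 0 := by
  rcases eq_or_lt_of_le (sub_nonneg.mpr (hx.trans hy)) with h | h
  · exact ⟨1, 0, by norm_num, le_rfl, by norm_num, by linarith⟩
  · refine ⟨y / (y - x), -x / (y - x), by positivity, div_nonneg (by linarith) h.le, ?_, ?_⟩
    · rw [← add_div, div_eq_one_iff_eq h.ne']
      ring
    · field_simp
      ring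

lemma not_pos_of_mul_opposite_signs {x y k : ℝ} (hx : 0 ≤ x) (hy : y ≤ 0) (hxk : 0 < x * k)
    (hyk : 0 < y * k) : False := by
  have h1 : 0 < k := pos_of_mul_pos_right hxk hx
  linarith [mul_nonpos_of_nonpos_of_nonneg hy h1.le]

/-- Zero exclusion along a ray of the imaginary axis: the rectangle spanned by the values of four
Hurwitz polynomials never contains zero. -/
lemma zero_notMem_rectangle {S : Set ℂ[X]} (hS : Convex ℝ S) {ρ : ℝ}
    (hdeg : ∀ P ∈ S, P.natDegree ≠ 0) (hρ : ∀ P ∈ S, ∀ z : ℂ, P.eval z = 0 → ‖z‖ ≤ ρ)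
    {σ : ℝ} (hσ : |σ| = 1) {A B C D : ℂ[X]} (hAS : A ∈ S) (hBS : B ∈ S) (hCS : C ∈ S)
    (hDS : D ∈ S) (hA : Hurwitz A) (hB : Hurwitz B) (hC : Hurwitz C) (hD : Hurwitz D)
    (hAB : ∀ τ : ℝ, (A.eval (σ * Complex.I * τ)).re = (B.eval (σ * Complex.I * τ)).re)
    (hCD : ∀ τ : ℝ, (C.eval (σ * Complex.I * τ)).re = (D.eval (σ * Complex.I * τ)).re)
    (hAC : ∀ τ : ℝ, (A.eval (σ * Complex.I * τ)).im = (C.eval (σ * Complex.I * τ)).im)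
    (hBD : ∀ τ : ℝ, (B.eval (σ * Complex.I * τ)).im = (D.eval (σ * Complex.I * τ)).im)
    {τ : ℝ} (hτ : 0 ≤ τ) :
    ¬ ((D.eval (σ * Complex.I * τ)).re ≤ 0 ∧ 0 ≤ (A.eval (σ * Complex.I * τ)).re ∧
      (D.eval (σ * Complex.I * τ)).im ≤ 0 ∧ 0 ≤ (A.eval (σ * Complex.I * τ)).im) := by
  have hσ0 : σ ≠ 0 := by
    rintro rfl
    simp at hσ
  -- equality of real or imaginary parts along the ray passes to derivatives
  have hre : ∀ {P Q : ℂ[X]},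
      (∀ τ : ℝ, (P.eval (σ * Complex.I * τ)).re = (Q.eval (σ * Complex.I * τ)).re) → ∀ τ : ℝ,
      ((σ * Complex.I) * P.derivative.eval (σ * Complex.I * τ)).re =
        ((σ * Complex.I) * Q.derivative.eval (σ * Complex.I * τ)).re := by
    intro P Q h τ
    have h1 := Complex.reCLM.hasFDerivAt.comp_hasDerivAt τ
      (hasDerivAt_eval_ray P (σ * Complex.I) τ)
    have h2 := Complex.reCLM.hasFDerivAt.comp_hasDerivAt τ
      (hasDerivAt_eval_ray Q (σ * Complex.I) τ)
    have e : (Complex.reCLM ∘ fun t : ℝ => P.eval (σ * Complex.I * t)) =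
        Complex.reCLM ∘ fun t : ℝ => Q.eval (σ * Complex.I * t) := funext h
    rw [e] at h1
    exact h1.unique h2
  have him : ∀ {P Q : ℂ[X]},
      (∀ τ : ℝ, (P.eval (σ * Complex.I * τ)).im = (Q.eval (σ * Complex.I * τ)).im) → ∀ τ : ℝ,
      ((σ * Complex.I) * P.derivative.eval (σ * Complex.I * τ)).im =
        ((σ * Complex.I) * Q.derivative.eval (σ * Complex.I * τ)).im := by
    intro P Q h τ
    have h1 := Complex.imCLM.hasFDerivAt.comp_hasDerivAt τ
      (hasDerivAt_eval_ray P (σ * Complex.I) τ)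
    have h2 := Complex.imCLM.hasFDerivAt.comp_hasDerivAt τ
      (hasDerivAt_eval_ray Q (σ * Complex.I) τ)
    have e : (Complex.imCLM ∘ fun t : ℝ => P.eval (σ * Complex.I * t)) =
        Complex.imCLM ∘ fun t : ℝ => Q.eval (σ * Complex.I * t) := funext h
    rw [e] at h1
    exact h1.unique h2
  have hcont : ∀ P : ℂ[X], Continuous fun t : ℝ => P.eval (σ * Complex.I * t) := fun P =>
    P.continuous.comp (by fun_prop)
  have hcre : ∀ P : ℂ[X], Continuous fun t : ℝ => (P.eval (σ * Complex.I * t)).re := fun P =>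
    Complex.continuous_re.comp (hcont P)
  have hcim : ∀ P : ℂ[X], Continuous fun t : ℝ => (P.eval (σ * Complex.I * t)).im := fun P =>
    Complex.continuous_im.comp (hcont P)
  let U : Set ℝ := {t | (D.eval (σ * Complex.I * t)).re < 0 ∧ 0 < (A.eval (σ * Complex.I * t)).re ∧
      (D.eval (σ * Complex.I * t)).im < 0 ∧ 0 < (A.eval (σ * Complex.I * t)).im}
  let V : Set ℝ := {t | (D.eval (σ * Complex.I * t)).re ≤ 0 ∧ 0 ≤ (A.eval (σ * Complex.I * t)).re ∧
      (D.eval (σ * Complex.I * t)).im ≤ 0 ∧ 0 ≤ (A.eval (σ * Complex.I * t)).im}ᶜ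
  have hU : IsOpen U :=
    (isOpen_lt (hcre D) continuous_const).inter ((isOpen_lt continuous_const (hcre A)).inter
      ((isOpen_lt (hcim D) continuous_const).inter (isOpen_lt continuous_const (hcim A))))
  have hV : IsOpen V := IsClosed.isOpen_compl (self :=
    (isClosed_le (hcre D) continuous_const).inter ((isClosed_le continuous_const (hcre A)).inter
      ((isClosed_le (hcim D) continuous_const).inter (isClosed_le continuous_const (hcim A)))))
  have hUV : Disjoint U V := by
    rw [Set.disjoint_left]
    rintro t ⟨h1, h2, h3, h4⟩ h
    exact h ⟨h1.le, h2.le, h3.le, h4.le⟩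
  -- zero never lies on the boundary of the rectangle, since the phases are monotone
  have hcover : Set.Ici (0 : ℝ) ⊆ U ∪ V := by
    intro t _
    by_cases h : t ∈ V
    · exact Or.inr h
    left
    obtain ⟨h1, h2, h3, h4⟩ := not_not.mp h
    have pA := hA.phase_pos (hdeg A hAS) hσ0 t
    have pB := hB.phase_pos (hdeg B hBS) hσ0 t
    have pC := hC.phase_pos (hdeg C hCS) hσ0 t
    have pD := hD.phase_pos (hdeg D hDS) hσ0 t
    rw [hre hAB, hAB, him hAC, hAC] at pA
    rw [him hBD, hBD] at pB
    rw [hre hCD, hCD] at pC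
    have h2' := h2
    have h4' := h4
    rw [hAB] at h2'
    rw [hAC] at h4'
    refine ⟨lt_of_le_of_ne h1 fun h0 => ?_, lt_of_le_of_ne h2 fun h0 => ?_,
      lt_of_le_of_ne h3 fun h0 => ?_, lt_of_le_of_ne h4 fun h0 => ?_⟩
    · rw [h0] at pC pD
      exact not_pos_of_mul_opposite_signs (k := -(σ * ((σ * Complex.I) * D.derivative.eval (σ * Complex.I * t)).re)) h4' h3
        (by linarith) (by linarith)
    · rw [hAB] at h0
      rw [← h0] at pA pB
      exact not_pos_of_mul_opposite_signs (k := -(σ * ((σ * Complex.I) * B.derivative.eval (σ * Complex.I * t)).re)) h4' h3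
        (by linarith) (by linarith)
    · rw [h0] at pB pD
      exact not_pos_of_mul_opposite_signs (k := σ * ((σ * Complex.I) * D.derivative.eval (σ * Complex.I * t)).im) h2' h1
        (by linarith) (by linarith)
    · rw [hAC] at h0
      rw [← h0] at pA pC
      exact not_pos_of_mul_opposite_signs (k := σ * ((σ * Complex.I) * C.derivative.eval (σ * Complex.I * t)).im) h2' h1
        (by linarith) (by linarith)
  have hfar : (Set.Ici (0 : ℝ) ∩ V).Nonempty := by
    refine ⟨|ρ| + 1, by simp; positivity, ?_⟩
    rintro ⟨h1, h2, h3, h4⟩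
    obtain ⟨s, t, hs, ht, hst, h5⟩ := exists_convex_combination_eq_zero h1 h2
    obtain ⟨s', t', hs', ht', hst', h6⟩ := exists_convex_combination_eq_zero h3 h4
    have hmem := hS (hS hDS hBS hs ht hst) (hS hCS hAS hs ht hst) hs' ht' hst'
    have h0 := hρ _ hmem (σ * Complex.I * ((|ρ| + 1 : ℝ) : ℂ)) ?_
    · have : ‖(σ * Complex.I * ((|ρ| + 1 : ℝ) : ℂ))‖ = |ρ| + 1 := by
        rw [norm_mul, norm_mul, Complex.norm_real, Complex.norm_real, Complex.norm_I,
          Real.norm_eq_abs, hσ, Real.norm_eq_abs, abs_of_nonneg (by positivity)]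
        ring
      rw [this] at h0
      linarith [le_abs_self ρ]
    · apply Complex.ext
      · simp only [eval_add, eval_smul, Complex.add_re, Complex.smul_re, smul_eq_mul,
          Complex.zero_re, ← hAB, hCD]
        linear_combination (s' + t') * h5
      · simp only [eval_add, eval_smul, Complex.add_im, Complex.smul_im, smul_eq_mul,
          Complex.zero_im, hBD, ← hAC]
        linear_combination (s + t) * h6
  exact isPreconnected_Ici.subset_right_of_subset_union hU hV hUV hcover hfar hτ

/-- If no polynomial of a segment has roots on the imaginary axis and the degree does not drop,
then the Hurwitz property is inherited from one end point by the other. -/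
lemma Hurwitz.of_segment {S : Set ℂ[X]} (hS : Convex ℝ S) {N : ℕ} {c ρ : ℝ} (hc : 0 < c)
    (hdeg : ∀ P ∈ S, P.natDegree = N ∧ c ≤ ‖P.leadingCoeff‖ ∧ ∀ z : ℂ, P.eval z = 0 → ‖z‖ ≤ ρ)
    (haxis : ∀ P ∈ S, ∀ z : ℂ, z.re = 0 → P.eval z ≠ 0) {P Q : ℂ[X]} (hPS : P ∈ S) (hQS : Q ∈ S)
    (hP : Hurwitz P) : Hurwitz Q := by
  let F : unitInterval → ℂ[X] := fun t => (1 - t : ℝ) • P + (t : ℝ) • Q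
  have hF : ∀ t, F t ∈ S := fun t =>
    hS hPS hQS (sub_nonneg.mpr t.2.2) t.2.1 (by ring)
  have hcont : Continuous fun x : unitInterval × ℂ => (F x.1).eval x.2 := by
    simp only [F, eval_add, eval_smul]
    have hP := P.continuous
    have hQ := Q.continuous
    fun_prop
  have hne : ∀ t, F t ≠ 0 := fun t h0 => by
    have := (hdeg _ (hF t)).2.1
    rw [h0] at this
    simp at this
    linarith
  let H : Set unitInterval := {t | Hurwitz (F t)}
  have hclosed : IsClosed H := by
    have : H = ⋂ z : {z : ℂ // 0 ≤ z.re}, {t | c * z.1.re ^ N ≤ ‖(F t).eval z.1‖} := by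
      ext t
      simp only [Set.mem_iInter, Set.mem_ofPred_eq, H]
      constructor
      · rintro ht ⟨z, hz⟩
        refine le_trans ?_ (ht.le_norm_eval hz)
        rw [(hdeg _ (hF t)).1]
        have := (hdeg _ (hF t)).2.1
        gcongr
      · intro h
        refine ⟨hne t, fun z hz => ?_⟩
        rcases hz.eq_or_lt with h0 | h0
        · exact haxis _ (hF t) z h0.symm
        · exact norm_pos_iff.mp (lt_of_lt_of_le (by positivity) (h ⟨z, hz⟩))
    rw [this]
    exact isClosed_iInter fun z => isClosed_le continuous_const
      (hcont.comp (continuous_id.prodMk continuous_const)).norm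
  have hopen : IsOpen H := by
    rw [← isClosed_compl_iff]
    have : Hᶜ = Prod.fst '' ({x : unitInterval × ℂ | (F x.1).eval x.2 = 0} ∩
        Set.univ ×ˢ (Metric.closedBall 0 ρ ∩ {z : ℂ | 0 ≤ z.re})) := by
      ext t
      simp only [H, Set.mem_compl_iff, Set.mem_ofPred_eq, Hurwitz, hne t, ne_eq, not_false_eq_true,
        true_and, not_forall, not_not, Set.mem_image, Set.mem_inter_iff, Set.mem_prod,
        Set.mem_univ, mem_closedBall_zero_iff, Prod.exists, exists_and_right, exists_eq_right]
      constructor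
      · rintro ⟨z, hz, h0⟩
        exact ⟨z, h0, (hdeg _ (hF t)).2.2 z h0, hz⟩
      · rintro ⟨z, h0, -, hz⟩
        exact ⟨z, hz, h0⟩
    rw [this]
    refine (IsCompact.image ?_ continuous_fst).isClosed
    refine IsCompact.inter_left (isCompact_univ.prod ?_) (isClosed_eq hcont continuous_const)
    exact (isCompact_closedBall _ _).inter_right
      (isClosed_le continuous_const Complex.continuous_re)
  have huniv : H = Set.univ :=
    IsClopen.eq_univ ⟨hclosed, hopen⟩ ⟨0, by simpa [H, F] using hP⟩
  have h1 : (1 : unitInterval) ∈ H := huniv ▸ Set.mem_univ _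
  simpa [H, F] using h1

lemma pick_mem {N : ℕ} {l u : ℕ → ℝ} (h : ∀ n ≤ N, l n ≤ u n) (p : ℕ → Bool) :
    ∀ n ≤ N, l n ≤ pick l u p n ∧ pick l u p n ≤ u n := by
  intro n hn
  unfold pick
  split_ifs
  · exact ⟨h n hn, le_rfl⟩
  · exact ⟨le_rfl, h n hn⟩

lemma eval_member_ray (N : ℕ) (a b : ℕ → ℝ) (u : ℂ) (τ : ℝ) :
    (member N a b).eval (u * τ) = ∑ n ∈ Finset.range (N + 1),
      (τ ^ n) • (((a n : ℂ) + (b n : ℂ) * Complex.I) * u ^ n) := by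
  rw [eval_member]
  refine Finset.sum_congr rfl fun n _ => ?_
  rw [Complex.real_smul]
  push_cast
  ring

lemma re_eval_ray_congr {N : ℕ} {a b a' b' : ℕ → ℝ} {u : ℂ}
    (h : ∀ n, (((a n : ℂ) + (b n : ℂ) * Complex.I) * u ^ n).re =
      (((a' n : ℂ) + (b' n : ℂ) * Complex.I) * u ^ n).re) (τ : ℝ) :
    ((member N a b).eval (u * τ)).re = ((member N a' b').eval (u * τ)).re := by
  simp only [eval_member_ray, Complex.re_sum, Complex.smul_re, h]

lemma im_eval_ray_congr {N : ℕ} {a b a' b' : ℕ → ℝ} {u : ℂ}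
    (h : ∀ n, (((a n : ℂ) + (b n : ℂ) * Complex.I) * u ^ n).im =
      (((a' n : ℂ) + (b' n : ℂ) * Complex.I) * u ^ n).im) (τ : ℝ) :
    ((member N a b).eval (u * τ)).im = ((member N a' b').eval (u * τ)).im := by
  simp only [eval_member_ray, Complex.im_sum, Complex.smul_im, h]

lemma re_eval_ray_le {N : ℕ} {a b a' b' : ℕ → ℝ} {u : ℂ}
    (h : ∀ n ≤ N, (((a n : ℂ) + (b n : ℂ) * Complex.I) * u ^ n).re ≤
      (((a' n : ℂ) + (b' n : ℂ) * Complex.I) * u ^ n).re) {τ : ℝ} (hτ : 0 ≤ τ) :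
    ((member N a b).eval (u * τ)).re ≤ ((member N a' b').eval (u * τ)).re := by
  simp only [eval_member_ray, Complex.re_sum, Complex.smul_re]
  exact Finset.sum_le_sum fun n hn => smul_le_smul_of_nonneg_left
    (h n (Nat.lt_succ_iff.mp (Finset.mem_range.mp hn))) (pow_nonneg hτ n)

lemma im_eval_ray_le {N : ℕ} {a b a' b' : ℕ → ℝ} {u : ℂ}
    (h : ∀ n ≤ N, (((a n : ℂ) + (b n : ℂ) * Complex.I) * u ^ n).im ≤
      (((a' n : ℂ) + (b' n : ℂ) * Complex.I) * u ^ n).im) {τ : ℝ} (hτ : 0 ≤ τ) :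
    ((member N a b).eval (u * τ)).im ≤ ((member N a' b').eval (u * τ)).im := by
  simp only [eval_member_ray, Complex.im_sum, Complex.smul_im]
  exact Finset.sum_le_sum fun n hn => smul_le_smul_of_nonneg_left
    (h n (Nat.lt_succ_iff.mp (Finset.mem_range.mp hn))) (pow_nonneg hτ n)

lemma signed_I_pow {σ : ℝ} (hσ : |σ| = 1) (n : ℕ) :
    ((σ : ℂ) * Complex.I) ^ n = ((σ : ℂ) * Complex.I) ^ (n % 4) := by
  apply pow_eq_pow_mod
  rcases eq_or_eq_neg_of_abs_eq hσ with rfl | rfl <;> norm_num [mul_pow]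

lemma mod_four_cases (n : ℕ) : n % 4 = 0 ∨ n % 4 = 1 ∨ n % 4 = 2 ∨ n % 4 = 3 := by
  omega

/-- Complex Kharitonov theorem (K8PT). -/
theorem k8pt (N : ℕ) (hN : 1 ≤ N) (la ua lb ub : ℕ → ℝ)
    (hA : ∀ n ≤ N, la n ≤ ua n) (hB : ∀ n ≤ N, lb n ≤ ub n)
    (hlead : ¬ (la N ≤ 0 ∧ 0 ≤ ua N ∧ lb N ≤ 0 ∧ 0 ≤ ub N))
    (hK1 : Hurwitz (member N (pick la ua (pat true true false false))
      (pick lb ub (pat true false false true))))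
    (hK2 : Hurwitz (member N (pick la ua (pat true false false true))
      (pick lb ub (pat false false true true))))
    (hK3 : Hurwitz (member N (pick la ua (pat false true true false))
      (pick lb ub (pat true true false false))))
    (hK4 : Hurwitz (member N (pick la ua (pat false false true true))
      (pick lb ub (pat false true true false))))
    (hK5 : Hurwitz (member N (pick la ua (pat true false false true))
      (pick lb ub (pat true true false false))))
    (hK6 : Hurwitz (member N (pick la ua (pat true true false false))
      (pick lb ub (pat false true true false))))
    (hK7 : Hurwitz (member N (pick la ua (pat false false true true))
      (pick lb ub (pat true false false true))))
    (hK8 : Hurwitz (member N (pick la ua (pat false true true false))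
      (pick lb ub (pat false false true true)))) :
    ∀ a b : ℕ → ℝ, (∀ n ≤ N, la n ≤ a n ∧ a n ≤ ua n) →
      (∀ n ≤ N, lb n ≤ b n ∧ b n ≤ ub n) → Hurwitz (member N a b) := by
  intro a b ha hb
  obtain ⟨c, ρ, hc, hfam⟩ := exists_bounds_intervalFamily hlead
  have hS := convex_intervalFamily N la ua lb ub
  have hmem : ∀ p q : ℕ → Bool,
      member N (pick la ua p) (pick lb ub q) ∈ intervalFamily N la ua lb ub := fun p q =>
    ⟨_, _, pick_mem hA p, pick_mem hB q, rfl⟩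
  have hdeg : ∀ P ∈ intervalFamily N la ua lb ub, P.natDegree ≠ 0 := fun P hP => by
    rw [(hfam P hP).1]
    omega
  have hρ := fun P hP => (hfam P hP).2.2
  refine Hurwitz.of_segment hS hc hfam ?_ (hmem _ _) ⟨a, b, ha, hb, rfl⟩ hK1
  rintro _ ⟨a, b, ha, hb, rfl⟩ z hz h0
  rcases le_total 0 z.im with hi | hi
  · have hzeq : z = ((1 : ℝ) : ℂ) * Complex.I * (z.im : ℝ) := by
      apply Complex.ext <;> simp [hz]
    have hex := zero_notMem_rectangle hS hdeg hρ (σ := 1) (by simp) (hmem _ _) (hmem _ _)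
      (hmem _ _) (hmem _ _) hK1 hK2 hK3 hK4 ?_ ?_ ?_ ?_ hi
    · rw [hzeq] at h0
      have hr := congrArg Complex.re h0
      have hm := congrArg Complex.im h0
      refine hex ⟨(re_eval_ray_le ?_ hi).trans hr.le,
        hr.ge.trans (re_eval_ray_le ?_ hi),
        (im_eval_ray_le ?_ hi).trans hm.le,
        hm.ge.trans (im_eval_ray_le ?_ hi)⟩
      all_goals
        intro n hn
        obtain ⟨ha1, ha2⟩ := ha n hn
        obtain ⟨hb1, hb2⟩ := hb n hn
        rw [signed_I_pow (by simp) n]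
        rcases mod_four_cases n with h | h | h | h <;>
          simp [pick, pat, h, pow_succ] <;> assumption
    all_goals
      first
        | refine re_eval_ray_congr fun n => ?_
        | refine im_eval_ray_congr fun n => ?_
      rw [signed_I_pow (by simp) n]
      rcases mod_four_cases n with h | h | h | h <;> simp [pick, pat, h, pow_succ]
  · have hzeq : z = ((-1 : ℝ) : ℂ) * Complex.I * ((-z.im : ℝ) : ℂ) := by
      apply Complex.ext <;> simp [hz]
    have hex := zero_notMem_rectangle hS hdeg hρ (σ := -1) (by simp) (hmem _ _) (hmem _ _)
      (hmem _ _) (hmem _ _) hK5 hK6 hK7 hK8 ?_ ?_ ?_ ?_ (neg_nonneg.mpr hi)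
    · rw [hzeq] at h0
      have hr := congrArg Complex.re h0
      have hm := congrArg Complex.im h0
      refine hex ⟨(re_eval_ray_le ?_ (neg_nonneg.mpr hi)).trans hr.le,
        hr.ge.trans (re_eval_ray_le ?_ (neg_nonneg.mpr hi)),
        (im_eval_ray_le ?_ (neg_nonneg.mpr hi)).trans hm.le,
        hm.ge.trans (im_eval_ray_le ?_ (neg_nonneg.mpr hi))⟩
      all_goals
        intro n hn
        obtain ⟨ha1, ha2⟩ := ha n hn
        obtain ⟨hb1, hb2⟩ := hb n hn
        rw [signed_I_pow (by simp) n]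
        rcases mod_four_cases n with h | h | h | h <;>
          simp [pick, pat, h, pow_succ] <;> assumption
    all_goals
      first
        | refine re_eval_ray_congr fun n => ?_
        | refine im_eval_ray_congr fun n => ?_
      rw [signed_I_pow (by simp) n]
      rcases mod_four_cases n with h | h | h | h <;> simp [pick, pat, h, pow_succ]
end

section
/- Correctness of the clockwise-rotation test (Case (i), complex case): Let N ≥ 1, α ∈ (0, π/2), and let la, ua, lb, ub : {0,…,N} → ℝ with la n ≤ ua n and lb n ≤ ub n for all n. Define rotated interval bounds Lc n = lo(cos(nα), la n, ua n) + lo(−sin(nα), lb n, ub n), Uc n = hi(cos(nα), la n, ua n) + hi(−sin(nα), lb n, ub n), Ld n = lo(sin(nα), la n, ua n) + lo(cos(nα), lb n, ub n), Ud n = hi(sin(nα), la n, ua n) + hi(cos(nα), lb n, ub n). Assume: (1) every member polynomial P_{a,b}(s) = Σ_{n=0}^N (a_n + i b_n) s^n with la n ≤ a_n ≤ ua n and lb n ≤ b_n ≤ ub n is Hurwitz, and (2) every polynomial Σ_{n=0}^N (c_n + i d_n) s^n with Lc n ≤ c_n ≤ Uc n and Ld n ≤ d_n ≤ Ud n is Hurwitz.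 Then for every member P_{a,b} of the original family and every root z ∈ ℂ of P_{a,b}, both Re z < 0 and Re(e^{-iα} z) < 0 hold; equivalently, arg(−z) ∈ (α − π/2, π/2), i.e. the sector {s : π/2 + α ≤ angle(s) < 3π/2} contains all roots of all members. -/
open Polynomial

/-- Lower endpoint of the interval `x·[p,q]` of interval arithmetic. -/
noncomputable def lo (x p q : ℝ) : ℝ := if 0 ≤ x then x * p else x * q

/-- Upper endpoint of the interval `x·[p,q]` of interval arithmetic. -/
noncomputable def hi (x p q : ℝ) : ℝ := if 0 ≤ x then x * q else x * p

theorem lo_le_mul {x p q y : ℝ} (hp : p ≤ y) (hq : y ≤ q) : lo x p q ≤ x * y := by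
  unfold lo
  split_ifs with hx
  · exact mul_le_mul_of_nonneg_left hp hx
  · exact mul_le_mul_of_nonpos_left hq (not_le.mp hx).le

theorem mul_le_hi {x p q y : ℝ} (hp : p ≤ y) (hq : y ≤ q) : x * y ≤ hi x p q := by
  unfold hi
  split_ifs with hx
  · exact mul_le_mul_of_nonneg_left hq hx
  · exact mul_le_mul_of_nonpos_left hp (not_le.mp hx).le

theorem rotate_coeff (a b θ : ℝ) :
    ((Real.cos θ * a + -Real.sin θ * b : ℝ) : ℂ) +
        ((Real.sin θ * a + Real.cos θ * b : ℝ) : ℂ) * Complex.I =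
      ((a : ℂ) + (b : ℂ) * Complex.I) * Complex.exp ((θ : ℂ) * Complex.I) := by
  rw [Complex.exp_mul_I, ← Complex.ofReal_cos, ← Complex.ofReal_sin]
  apply Complex.ext <;> simp <;> ring

/-- Multiplying the `n`-th coefficient by `e^{inα}` rotates the roots by `e^{-iα}`. -/
theorem eval_member_rotate (N : ℕ) (a b : ℕ → ℝ) (α : ℝ) (z : ℂ) :
    (member N (fun n => Real.cos (n * α) * a n + -Real.sin (n * α) * b n)
        (fun n => Real.sin (n * α) * a n + Real.cos (n * α) * b n)).eval
      (Complex.exp (-(α : ℂ) * Complex.I) * z) = (member N a b).eval z := by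
  simp only [member, eval_finsetSum, eval_mul, eval_C, eval_pow, eval_X]
  refine Finset.sum_congr rfl fun n _ => ?_
  rw [rotate_coeff, mul_pow, ← Complex.exp_nat_mul, mul_assoc, ← mul_assoc (Complex.exp _),
    ← Complex.exp_add]
  have h : ((n * α : ℝ) : ℂ) * Complex.I + (n : ℂ) * (-(α : ℂ) * Complex.I) = 0 := by
    push_cast
    ring
  rw [h, Complex.exp_zero, one_mul]

theorem re_exp_neg_mul_I_mul (α : ℝ) (w : ℂ) :
    (Complex.exp (-(α : ℂ) * Complex.I) * w).re = ‖w‖ * Real.cos (w.arg - α) := by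
  conv_lhs => rw [← Complex.norm_mul_exp_arg_mul_I w]
  rw [mul_left_comm, ← Complex.exp_add, Complex.re_ofReal_mul]
  have h : -(α : ℂ) * Complex.I + (w.arg : ℂ) * Complex.I
      = ((w.arg - α : ℝ) : ℂ) * Complex.I := by
    push_cast
    ring
  rw [h, Complex.exp_ofReal_mul_I_re]

/-- A point of the open right half-plane that stays there after a clockwise rotation by
`α ≤ π/2` has argument in `(α - π/2, π/2)`. -/
theorem arg_mem_Ioo_of_re_pos {α : ℝ} (hα : α ≤ Real.pi / 2) {w : ℂ} (hw : 0 < w.re)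
    (hr : 0 < (Complex.exp (-(α : ℂ) * Complex.I) * w).re) :
    w.arg ∈ Set.Ioo (α - Real.pi / 2) (Real.pi / 2) := by
  obtain ⟨hl, hu⟩ := abs_lt.mp (Complex.abs_arg_lt_pi_div_two_iff.mpr (Or.inl hw))
  refine ⟨?_, hu⟩
  by_contra! hle
  have hcos : Real.cos (w.arg - α) ≤ 0 := by
    rw [← Real.cos_neg]
    exact Real.cos_nonpos_of_pi_div_two_le_of_le (by linarith) (by linarith [Real.pi_pos])
  rw [re_exp_neg_mul_I_mul] at hr
  exact hr.not_ge (mul_nonpos_of_nonneg_of_nonpos (norm_nonneg w) hcos)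

/-- Correctness of the clockwise-rotation test (Case (i), complex case): if the original
family and the rotated family (with interval coefficients enclosing `e^{inα}(a_n + i b_n)`)
are both robustly Hurwitz, then every root `z` of every member satisfies `Re z < 0` and
`Re (e^{-iα} z) < 0`, i.e. `arg (−z) ∈ (α − π/2, π/2)`. -/
theorem rotation_test_cw (N : ℕ) (hN : 1 ≤ N) (α : ℝ)
    (hα : 0 < α ∧ α < Real.pi / 2)
    (la ua lb ub : ℕ → ℝ)
    (hA : ∀ n ≤ N, la n ≤ ua n) (hB : ∀ n ≤ N, lb n ≤ ub n)
    (h1 : ∀ a b : ℕ → ℝ, (∀ n ≤ N, la n ≤ a n ∧ a n ≤ ua n) →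
      (∀ n ≤ N, lb n ≤ b n ∧ b n ≤ ub n) → Hurwitz (member N a b))
    (h2 : ∀ c d : ℕ → ℝ,
      (∀ n ≤ N, lo (Real.cos (n * α)) (la n) (ua n) + lo (-Real.sin (n * α)) (lb n) (ub n) ≤ c n ∧
        c n ≤ hi (Real.cos (n * α)) (la n) (ua n) + hi (-Real.sin (n * α)) (lb n) (ub n)) →
      (∀ n ≤ N, lo (Real.sin (n * α)) (la n) (ua n) + lo (Real.cos (n * α)) (lb n) (ub n) ≤ d n ∧
        d n ≤ hi (Real.sin (n * α)) (la n) (ua n) + hi (Real.cos (n * α)) (lb n) (ub n)) →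
      Hurwitz (member N c d)) :
    ∀ a b : ℕ → ℝ, (∀ n ≤ N, la n ≤ a n ∧ a n ≤ ua n) →
      (∀ n ≤ N, lb n ≤ b n ∧ b n ≤ ub n) →
      ∀ z : ℂ, (member N a b).eval z = 0 →
        (z.re < 0 ∧ (Complex.exp (-(α : ℂ) * Complex.I) * z).re < 0) ∧
        Complex.arg (-z) ∈ Set.Ioo (α - Real.pi / 2) (Real.pi / 2) := by
  intro a b ha hb z hz
  have hre : z.re < 0 := by
    by_contra! h
    exact (h1 a b ha hb).2 z h hz
  have hrot : (Complex.exp (-(α : ℂ) * Complex.I) * z).re < 0 := by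
    by_contra! h
    refine (h2 _ _ (fun n hn => ⟨?_, ?_⟩) (fun n hn => ⟨?_, ?_⟩)).2 _ h
      ((eval_member_rotate N a b α z).trans hz)
    · exact add_le_add (lo_le_mul (ha n hn).1 (ha n hn).2) (lo_le_mul (hb n hn).1 (hb n hn).2)
    · exact add_le_add (mul_le_hi (ha n hn).1 (ha n hn).2) (mul_le_hi (hb n hn).1 (hb n hn).2)
    · exact add_le_add (lo_le_mul (ha n hn).1 (ha n hn).2) (lo_le_mul (hb n hn).1 (hb n hn).2)
    · exact add_le_add (mul_le_hi (ha n hn).1 (ha n hn).2) (mul_le_hi (hb n hn).1 (hb n hn).2)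
  refine ⟨⟨hre, hrot⟩, arg_mem_Ioo_of_re_pos hα.2.le ?_ ?_⟩
  · simpa using hre
  · rw [mul_neg, Complex.neg_re]
    exact neg_pos.mpr hrot
end
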